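/- If δ = δ₁, then u_δ′(x) > 0 for every x ∈ ℝ, −1 < u_δ(x) < 1 for every x ∈ ℝ, and lim_{x→+∞} u_δ(x) = 1, lim_{x→−∞} u_δ(x) = −1. In particular there exists an increasing heteroclinic solution of the one-dimensional equation connecting −1 to 1. -/

import Mathlib

noncomputable section

open Real Filter Topology intervalIntegral

/-- The normalized nonlinearity `f_{a,A}`: `f/a` where `f > 0`, `f/A` where `f < 0`,
and `0` where `f = 0`. -/
def faA (a A : ℝ) (f : ℝ → ℝ) (t : ℝ) : ℝ :=
  if 0 < f t then f t / a else if f t < 0 then f t / A else 0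

/-- `u` is a weak solution of `-|u'|^α u'' = f_{a,A}(u)` on all of `ℝ`:
`u` is C¹ and `x ↦ |u'|^α u'` is differentiable with (continuous) derivative
`-(1+α)·f_{a,A}(u(x))`. -/
def IsWeakSolR (α a A : ℝ) (f : ℝ → ℝ) (u : ℝ → ℝ) : Prop :=
  Differentiable ℝ u ∧ Continuous (deriv u) ∧
  ∀ x : ℝ, HasDerivAt (fun y => |deriv u y| ^ α * deriv u y)
    (-(1 + α) * faA a A f (u x)) x

/-- A differentiable function on `ℝ` whose derivative is bounded by a multiple of the function
wherever the latter is small vanishes identically as soon as it vanishes at one point. -/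
theorem eq_zero_of_abs_deriv_le_mul_abs {w : ℝ → ℝ} (hw : Differentiable ℝ w) {C : ℝ}
    (h : ∀ x, |w x| ≤ 1 → |deriv w x| ≤ C * |w x|) {x₀ : ℝ} (hx₀ : w x₀ = 0) (x : ℝ) :
    w x = 0 := by
  have key : ∀ v : ℝ → ℝ, Differentiable ℝ v → (∀ x, |v x| ≤ 1 → |deriv v x| ≤ C * |v x|) →
      ∀ y, v y = 0 → ∃ r > 0, ∀ z ∈ Set.Icc y (y + r), v z = 0 := by
    intro v hv hb y hy
    have hsmall : ∀ᶠ z in 𝓝 y, |v z| < 1 :=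
      (hv.continuous.abs.continuousAt (x := y)).eventually_lt continuousAt_const (by simp [hy])
    obtain ⟨r, hr, hball⟩ := Metric.eventually_nhds_iff.mp hsmall
    refine ⟨r / 2, by positivity, ?_⟩
    refine eq_zero_of_abs_deriv_le_mul_abs_self_of_eq_zero_right (f' := deriv v) (K := C)
      hv.continuous.continuousOn (fun z _ => (hv z).hasDerivAt.hasDerivWithinAt) hy ?_
    intro z hz
    refine hb z (hball ?_).le
    rw [Real.dist_eq, abs_lt]
    constructor <;> linarith [hz.1, hz.2]
  have hopen : IsOpen {x | w x = 0} := by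
    rw [Metric.isOpen_iff]
    intro y hy
    obtain ⟨r, hr, h₁⟩ := key w hw h y hy
    obtain ⟨r', hr', h₂⟩ := key (fun x => w (-x)) (hw.comp differentiable_neg)
      (fun x hx => by rw [deriv_comp_neg, abs_neg]; exact h (-x) hx) (-y) (by simpa using hy)
    refine ⟨min r r', lt_min hr hr', fun z hz => ?_⟩
    rw [Metric.mem_ball, Real.dist_eq, abs_lt] at hz
    have := min_le_left r r'
    have := min_le_right r r'
    rcases le_total y z with hyz | hyz
    · exact h₁ z ⟨hyz, by linarith [hz.2]⟩
    · simpa using h₂ (-z) ⟨by linarith, by linarith [hz.1]⟩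
  have hclopen : IsClopen {x | w x = 0} :=
    ⟨isClosed_eq hw.continuous continuous_const, hopen⟩
  exact isPreconnected_univ.subset_isClopen hclopen ⟨x₀, trivial, hx₀⟩ (Set.mem_univ x)

/-- A differentiable function on `ℝ` with `|w'| ^ s ≤ M * w ^ 2`, `0 < s ≤ 2`, vanishes
identically as soon as it vanishes at one point. -/
theorem eq_zero_of_abs_deriv_rpow_le_mul_sq {w : ℝ → ℝ} (hw : Differentiable ℝ w) {s M : ℝ}
    (hs : 0 < s) (hs2 : s ≤ 2) (hM : 0 ≤ M) (h : ∀ x, |deriv w x| ^ s ≤ M * w x ^ 2)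
    {x₀ : ℝ} (hx₀ : w x₀ = 0) (x : ℝ) : w x = 0 := by
  refine eq_zero_of_abs_deriv_le_mul_abs hw (C := M ^ (1 / s)) (fun y hy => ?_) hx₀ x
  have hsq : w y ^ 2 ≤ |w y| ^ s := by
    rw [← sq_abs, ← Real.rpow_natCast]
    rcases (abs_nonneg (w y)).eq_or_lt with h0 | h0
    · rw [← h0, Real.zero_rpow (by norm_num), Real.zero_rpow hs.ne']
    · exact Real.rpow_le_rpow_of_exponent_ge h0 hy (by exact_mod_cast hs2)
  rw [← Real.rpow_le_rpow_iff (abs_nonneg _) (by positivity) hs,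
    Real.mul_rpow (by positivity) (abs_nonneg _), ← Real.rpow_mul hM,
    one_div_mul_cancel hs.ne', Real.rpow_one]
  exact (h y).trans (mul_le_mul_of_nonneg_left hsq hM)

/-- If `u` converges at `+∞` and `φ (u') = g (u)` with `φ`, `g` continuous, then the limit `L`
satisfies `g L = φ 0`. -/
theorem eq_of_tendsto_of_comp_deriv_eq {u φ g : ℝ → ℝ} (hu : Differentiable ℝ u)
    (hφ : Continuous φ) (hg : Continuous g) (h : ∀ x, φ (deriv u x) = g (u x)) {L : ℝ}
    (hL : Tendsto u atTop (𝓝 L)) : g L = φ 0 := by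
  have hmvt : ∀ x : ℝ, ∃ c ∈ Set.Ioo x (x + 1), deriv u c = u (x + 1) - u x := by
    intro x
    obtain ⟨c, hc, hc'⟩ := exists_deriv_eq_slope u (lt_add_one x) hu.continuous.continuousOn
      hu.differentiableOn
    exact ⟨c, hc, by simpa using hc'⟩
  choose c hc hc' using hmvt
  have hctop : Tendsto c atTop atTop := tendsto_atTop_mono (fun x => (hc x).1.le) tendsto_id
  have hdiff : Tendsto (fun x => deriv u (c x)) atTop (𝓝 0) := by
    simp_rw [hc']
    simpa using (hL.comp (tendsto_atTop_add_const_right atTop (1 : ℝ) tendsto_id)).sub hL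
  have h₁ : Tendsto (fun x => g (u (c x))) atTop (𝓝 (g L)) :=
    (hg.tendsto L).comp (hL.comp hctop)
  have h₂ : Tendsto (fun x => g (u (c x))) atTop (𝓝 (φ 0)) := by
    simp_rw [← h]
    exact (hφ.tendsto 0).comp hdiff
  exact tendsto_nhds_unique h₁ h₂

theorem faA_eq_max_div_sub_max_div (a A : ℝ) (f : ℝ → ℝ) (t : ℝ) :
    faA a A f t = max (f t) 0 / a - max (-f t) 0 / A := by
  unfold faA
  split_ifs with h₁ h₂
  · rw [max_eq_left h₁.le, max_eq_right (by linarith)]; simp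
  · rw [max_eq_right h₂.le, max_eq_left (by linarith)]; ring
  · have : f t = 0 := by linarith
    simp [this]

theorem continuous_faA {a A : ℝ} {f : ℝ → ℝ} (hf : Continuous f) : Continuous (faA a A f) := by
  rw [funext (faA_eq_max_div_sub_max_div a A f)]
  exact ((hf.max continuous_const).div_const a).sub ((hf.neg.max continuous_const).div_const A)

theorem abs_faA_le {a A : ℝ} (ha : 0 < a) (haA : a ≤ A) (f : ℝ → ℝ) (t : ℝ) :
    |faA a A f t| ≤ |f t| / a := by
  have hA : 0 < A := ha.trans_le haA
  unfold faA
  split_ifs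
  · rw [abs_div, abs_of_pos ha]
  · rw [abs_div, abs_of_pos hA]
    gcongr
  · rw [abs_zero]; positivity

/-- Near a zero `c` of a Lipschitz `f`, the primitive of `f_{a,A}` grows at most quadratically. -/
theorem abs_integral_faA_le_mul_sq {a A : ℝ} (ha : 0 < a) (haA : a ≤ A) {f : ℝ → ℝ} {K : NNReal}
    (hf : LipschitzWith K f) {c : ℝ} (hc : f c = 0) (t : ℝ) :
    |∫ s in t..c, faA a A f s| ≤ K / a * (t - c) ^ 2 := by
  have hbound : ∀ s ∈ Set.uIoc t c, ‖faA a A f s‖ ≤ K * |t - c| / a := by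
    intro s hs
    refine (abs_faA_le ha haA f s).trans ?_
    gcongr
    calc |f s| = |f s - f c| := by rw [hc, sub_zero]
      _ ≤ K * |s - c| := by simpa [Real.dist_eq] using hf.dist_le_mul s c
      _ ≤ K * |t - c| := by
        refine mul_le_mul_of_nonneg_left ?_ K.coe_nonneg
        rw [abs_sub_comm s, abs_sub_comm t]
        exact Set.abs_sub_right_of_mem_uIcc (Set.uIoc_subset_uIcc hs)
  refine (intervalIntegral.norm_integral_le_of_norm_le_const hbound).trans_eq ?_
  rw [abs_sub_comm c t, ← sq_abs (t - c)]
  ring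

theorem hasDerivAt_integral_faA {a A : ℝ} {f : ℝ → ℝ} (hf : Continuous f) (b t : ℝ) :
    HasDerivAt (fun t => ∫ s in t..b, faA a A f s) (-faA a A f t) t :=
  integral_hasDerivAt_left ((continuous_faA hf).intervalIntegrable _ _)
    (continuous_faA hf).aestronglyMeasurable.stronglyMeasurableAtFilter
    (continuous_faA hf).continuousAt

/-- Conservation of energy for weak solutions of `-|u'|^α u'' = f_{a,A}(u)`. -/
theorem IsWeakSolR.abs_deriv_rpow_sub_integral_eq {α a A : ℝ} (hα : -1 < α) {f u : ℝ → ℝ}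
    (hf : Continuous f) (hu : IsWeakSolR α a A f u) (b x y : ℝ) :
    |deriv u x| ^ (2 + α) - (2 + α) * ∫ s in u x..b, faA a A f s =
      |deriv u y| ^ (2 + α) - (2 + α) * ∫ s in u y..b, faA a A f s := by
  obtain ⟨hdiff, -, hw⟩ := hu
  have h1 : 0 < 1 + α := by linarith
  have hp : 1 < (2 + α) / (1 + α) := by rw [lt_div_iff₀ h1]; linarith
  have habs : ∀ d : ℝ, |(|d| ^ α * d)| ^ ((2 + α) / (1 + α)) = |d| ^ (2 + α) := by
    intro d
    rcases eq_or_ne d 0 with rfl | hd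
    · rw [mul_zero, abs_zero, Real.zero_rpow (by linarith), Real.zero_rpow (by linarith)]
    · have hd' : 0 < |d| := abs_pos.mpr hd
      rw [abs_mul, abs_of_nonneg (by positivity : 0 ≤ |d| ^ α), ← Real.rpow_add_one hd'.ne',
        ← Real.rpow_mul hd'.le]
      congr 1
      field_simp
      ring
  have hpow : ∀ d : ℝ,
      |(|d| ^ α * d)| ^ ((2 + α) / (1 + α) - 2) * (|d| ^ α * d) = d := by
    intro d
    rcases eq_or_ne d 0 with rfl | hd
    · simp
    · have hd' : 0 < |d| := abs_pos.mpr hd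
      rw [abs_mul, abs_of_nonneg (by positivity : 0 ≤ |d| ^ α), ← Real.rpow_add_one hd'.ne',
        ← Real.rpow_mul hd'.le, ← mul_assoc, ← Real.rpow_add hd']
      rw [show (α + 1) * ((2 + α) / (1 + α) - 2) + α = 0 by field_simp; ring, Real.rpow_zero,
        one_mul]
  have hE : ∀ x, HasDerivAt
      (fun x => |deriv u x| ^ (2 + α) - (2 + α) * ∫ s in u x..b, faA a A f s) 0 x := by
    intro x
    have hkin := (hasDerivAt_abs_rpow (|deriv u x| ^ α * deriv u x) hp).comp x (hw x)
    have hpot := ((hasDerivAt_integral_faA (a := a) (A := A) hf b (u x)).comp x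
      (hdiff x).hasDerivAt).const_mul (2 + α)
    refine ((hkin.congr_of_eventuallyEq (.of_forall fun z => (habs _).symm)).sub
      hpot).congr_deriv ?_
    rw [mul_assoc ((2 + α) / (1 + α)), hpow]
    field_simp
    ring
  exact is_const_of_deriv_eq_zero (fun x => (hE x).differentiableAt) (fun x => (hE x).deriv) x y

/-- A bounded increasing function with `φ (u') = g (u)`, where the only point of `[u 0, 1]` at
which `g` equals `φ 0` is `1`, tends to `1` at `+∞`. -/
theorem tendsto_one_of_comp_deriv_eq {u φ g : ℝ → ℝ} (hu : Differentiable ℝ u)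
    (hφ : Continuous φ) (hg : Continuous g) (h : ∀ x, φ (deriv u x) = g (u x))
    (hmono : Monotone u) (hlt : ∀ x, u x < 1)
    (hzero : ∀ t, u 0 ≤ t → t ≤ 1 → g t = φ 0 → t = 1) : Tendsto u atTop (𝓝 1) := by
  have hbdd : BddAbove (Set.range u) := ⟨1, by rintro _ ⟨x, rfl⟩; exact (hlt x).le⟩
  have hL := tendsto_atTop_ciSup hmono hbdd
  rwa [hzero _ (le_ciSup hbdd 0) (ciSup_le fun x => (hlt x).le)
    (eq_of_tendsto_of_comp_deriv_eq hu hφ hg h hL)] at hL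

/-- **Proposition 5.2, case 2.** If `δ = δ₁`, then `u_δ' > 0` everywhere,
`-1 < u_δ < 1`, and `u_δ(x) → ±1` as `x → ±∞`: `u_δ` is an increasing
heteroclinic solution connecting `-1` to `1`. -/
theorem cauchy_case_critical
    (α a A : ℝ) (hα : -1 < α) (hα0 : α ≤ 0) (ha : 0 < a) (haA : a ≤ A)
    (f : ℝ → ℝ) (hf : ContDiff ℝ 1 f)
    (hfm1 : f (-1) = 0) (hf0 : f 0 = 0) (hf1 : f 1 = 0)
    (hfpos : ∀ t ∈ Set.Ioo (0:ℝ) 1, 0 < f t)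
    (hfneg : ∀ t ∈ Set.Ioo (-1:ℝ) 0, f t < 0)
    (hfge : ∀ t : ℝ, t ≤ -1 → 0 ≤ f t)
    (hfle : ∀ t : ℝ, 1 ≤ t → f t ≤ 0)
    (hfbd : ∃ K : ℝ, ∀ t, |f t| ≤ K)
    (hfLip : ∃ K : NNReal, LipschitzWith K f)
    (hfd1 : deriv f 1 < 0) (hfdm1 : deriv f (-1) < 0)
    (hbal : (∫ s in (-1:ℝ)..1, faA a A f s) = 0)
    (hint : ∀ t : ℝ, t ≠ -1 → t ≠ 1 → 0 < ∫ s in t..1, faA a A f s)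
    (δ δ₁ : ℝ)
    (hδ₁ : δ₁ = ((2 + α) * ∫ s in (0:ℝ)..1, f s / a) ^ ((1:ℝ) / (2 + α)))
    (u : ℝ → ℝ) (hu : IsWeakSolR α a A f u)
    (hu0 : u 0 = 0) (hud0 : deriv u 0 = δ)
    (hδ : δ = δ₁) :
    (∀ x : ℝ, 0 < deriv u x) ∧
    (∀ x : ℝ, -1 < u x ∧ u x < 1) ∧
    Tendsto u atTop (𝓝 1) ∧ Tendsto u atBot (𝓝 (-1)) := by
  obtain ⟨K, hK⟩ := hfLip
  have hs : 0 < 2 + α := by linarith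
  obtain ⟨hdiff, hcont, -⟩ := id hu
  set G : ℝ → ℝ := fun t => ∫ s in t..1, faA a A f s with hG
  have hGcont : Continuous G :=
    continuous_iff_continuousAt.mpr fun t => (hasDerivAt_integral_faA hf.continuous 1 t).continuousAt
  have hG0 : ∫ s in (0 : ℝ)..1, f s / a = G 0 := by
    refine intervalIntegral.integral_congr_ae (.of_forall fun s hs' => ?_)
    rw [Set.uIoc_of_le zero_le_one] at hs'
    rcases hs'.2.eq_or_lt with rfl | h1
    · simp [faA, hf1]
    · simp [faA, hfpos s ⟨hs'.1, h1⟩]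
  have hG0pos : 0 < G 0 := hint 0 (by norm_num) (by norm_num)
  have hδpow : δ ^ (2 + α) = (2 + α) * G 0 := by
    rw [hδ, hδ₁, hG0, ← Real.rpow_mul (by positivity), one_div_mul_cancel hs.ne', Real.rpow_one]
  have hδpos : 0 < δ := by
    rw [hδ, hδ₁, hG0]
    positivity
  have henergy : ∀ x, |deriv u x| ^ (2 + α) = (2 + α) * G (u x) := by
    intro x
    have := hu.abs_deriv_rpow_sub_integral_eq hα hf.continuous 1 x 0
    rw [hu0, hud0, abs_of_pos hδpos, hδpow, sub_self, sub_eq_zero] at this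
    exact this
  have hGle : ∀ c, f c = 0 → G c = 0 → ∀ t, G t ≤ K / a * (t - c) ^ 2 := by
    intro c hc hGc t
    have hadd := intervalIntegral.integral_add_adjacent_intervals (μ := MeasureTheory.volume)
      ((continuous_faA (a := a) (A := A) hf.continuous).intervalIntegrable t c)
      ((continuous_faA (a := a) (A := A) hf.continuous).intervalIntegrable c 1)
    have : G t = ∫ s in t..c, faA a A f s := by
      change (∫ s in c..1, faA a A f s) = 0 at hGc
      rw [hGc, add_zero] at hadd
      exact hadd.symm
    rw [this]
    exact (le_abs_self _).trans (abs_integral_faA_le_mul_sq ha haA hK hc t)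
  have hne : ∀ c, f c = 0 → G c = 0 → c ≠ 0 → ∀ x, u x ≠ c := by
    intro c hc hGc hc0 x hx
    have hzero := eq_zero_of_abs_deriv_rpow_le_mul_sq (w := fun x => u x - c)
      (hdiff.sub_const c) (M := (2 + α) * (K / a)) hs (by linarith) (by positivity)
      (fun y => by
        rw [deriv_sub_const, henergy y, mul_assoc]
        exact mul_le_mul_of_nonneg_left (hGle c hc hGc (u y)) hs.le)
      (sub_eq_zero.mpr hx) 0
    rw [hu0] at hzero
    exact hc0 (by linarith)
  have hne1 : ∀ x, u x ≠ 1 := hne 1 hf1 intervalIntegral.integral_same one_ne_zero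
  have hnem1 : ∀ x, u x ≠ -1 := hne (-1) hfm1 hbal (by norm_num)
  have hdne : ∀ x, deriv u x ≠ 0 := by
    intro x hx
    have hpos : 0 < G (u x) := hint _ (hnem1 x) (hne1 x)
    have := henergy x
    rw [hx, abs_zero, Real.zero_rpow hs.ne'] at this
    exact absurd this (by positivity)
  have hdpos : ∀ x, 0 < deriv u x := by
    intro x
    by_contra! hx
    obtain ⟨z, hz⟩ := mem_range_of_exists_le_of_exists_ge hcont ⟨x, hx⟩ ⟨0, (hud0 ▸ hδpos).le⟩
    exact hdne z hz
  have hmono : Monotone u := (strictMono_of_deriv_pos hdpos).monotone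
  have hlt : ∀ x, u x < 1 := by
    intro x
    by_contra! hx
    obtain ⟨z, hz⟩ := mem_range_of_exists_le_of_exists_ge hdiff.continuous
      ⟨0, hu0.trans_le zero_le_one⟩ ⟨x, hx⟩
    exact hne1 z hz
  have hgt : ∀ x, -1 < u x := by
    intro x
    by_contra! hx
    obtain ⟨z, hz⟩ := mem_range_of_exists_le_of_exists_ge hdiff.continuous
      ⟨x, hx⟩ ⟨0, (by rw [hu0]; norm_num)⟩
    exact hnem1 z hz
  have hφ : Continuous fun d : ℝ => |d| ^ (2 + α) :=
    continuous_abs.rpow_const fun _ => Or.inr hs.le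
  have hGzero : ∀ t, -1 < t → t < 1 → (2 + α) * G t ≠ |(0 : ℝ)| ^ (2 + α) := by
    intro t h₁ h₂
    have hpos : 0 < G t := hint t h₁.ne' h₂.ne
    rw [abs_zero, Real.zero_rpow hs.ne']
    positivity
  refine ⟨hdpos, fun x => ⟨hgt x, hlt x⟩, ?_, ?_⟩
  · refine tendsto_one_of_comp_deriv_eq hdiff hφ (continuous_const.mul hGcont) henergy hmono hlt ?_
    intro t ht ht1 hGt
    by_contra hne
    exact hGzero t (by linarith) (lt_of_le_of_ne ht1 hne) hGt
  · have hrefl : Tendsto (fun x => -u (-x)) atTop (𝓝 1) := by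
      refine tendsto_one_of_comp_deriv_eq (φ := fun d => |d| ^ (2 + α))
        (g := fun t => (2 + α) * G (-t)) (hdiff.comp differentiable_neg).neg hφ
        (continuous_const.mul (hGcont.comp continuous_neg)) ?_
        (fun x y hxy => neg_le_neg (hmono (neg_le_neg hxy))) (fun x => by linarith [hgt (-x)]) ?_
      · intro x
        rw [deriv.fun_neg, deriv_comp_neg, neg_neg, neg_neg]
        exact henergy (-x)
      · intro t ht ht1 hGt
        simp only [neg_zero, hu0] at ht
        by_contra hne
        exact hGzero (-t) (by linarith [lt_of_le_of_ne ht1 hne]) (by linarith) hGt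
    have := (hrefl.comp tendsto_neg_atBot_atTop).neg
    simpa [Function.comp_def] using this
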